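/- arXiv:1101.4603 — 2 statements merged into one kernel-verified Lean document; each statement's English description precedes it below -/
import Mathlib

section
/- For 0 ≤ s < q−1, the evaluation code C_E(s) on the elliptic quadric E ⊂ P³ over F_q has length q²+1, dimension (s+1)², and minimum distance q²+1−s(q+1); moreover it is permutation equivalent to the extended BCH code B₀^{ext}(s). -/
theorem exists_root_of_finrank_eq_two {F K : Type*} [Field F] [Field K] [Algebra F K]
    [Finite F] [Finite K] (hK : Module.finrank F K = 2) {t n : F}
    (hirr : ∀ u v : F, u ^ 2 + t * u * v + n * v ^ 2 = 0 → u = 0 ∧ v = 0) :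
    ∃ α : K, α ^ 2 + algebraMap F K t * α + algebraMap F K n = 0 := by
  open Polynomial in
  set f : F[X] := X ^ 2 + C t * X + C n with hf
  have hm : f.Monic := by rw [hf]; monicity!
  have hd : f.natDegree = 2 := by rw [hf]; compute_degree!
  have hi : Irreducible f := by
    rw [hm.irreducible_iff_roots_eq_zero_of_degree_le_three (by omega) (by omega)]
    rw [Multiset.eq_zero_iff_forall_notMem]
    intro a ha
    have h0 := (mem_roots'.1 ha).2
    have := hirr a 1 (by simpa [hf] using h0)
    simp at this
  have : Fact (Irreducible f) := ⟨hi⟩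
  have hfd : Module.finrank F (AdjoinRoot f) = 2 := by
    rw [(AdjoinRoot.powerBasis hm.ne_zero).finrank, AdjoinRoot.powerBasis_dim, hd]
  have : Module.Finite F (AdjoinRoot f) := .of_basis (AdjoinRoot.powerBasis hm.ne_zero).basis
  have : Finite (AdjoinRoot f) := Module.finite_of_finite F
  obtain ⟨g⟩ := FiniteField.nonempty_algHom_of_finrank_dvd (F := F) (K := AdjoinRoot f) (L := K)
    (by rw [hfd, hK])
  refine ⟨g (AdjoinRoot.root f), ?_⟩
  have h := congrArg g (AdjoinRoot.eval₂_root f)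
  simpa [hf, ← AdjoinRoot.algebraMap_eq] using h

theorem exists_algebraMap_eq_of_pow_card_eq_self {F K : Type*} [Field F] [Field K] [Algebra F K]
    [Fintype F] {α : K} (hα : α ^ Fintype.card F = α) : ∃ a : F, algebraMap F K a = α := by
  by_contra! hnot
  have hF := Fintype.one_lt_card (α := F)
  refine FiniteField.X_pow_card_sub_X_ne_zero K hF ?_
  refine Polynomial.eq_zero_of_natDegree_lt_card_of_eval_eq_zero _
    (f := fun o : Option F => o.elim α (algebraMap F K)) ?_ ?_ ?_
  · rintro (_ | a) (_ | b) h
    · rfl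
    · exact (hnot b h.symm).elim
    · exact (hnot a h).elim
    · exact congrArg some ((algebraMap F K).injective h)
  · rintro (_ | a)
    · simp [hα]
    · simp [← map_pow, FiniteField.pow_card]
  · rw [FiniteField.X_pow_card_sub_X_natDegree_eq K hF, Fintype.card_option]
    omega

/-- The roots of an anisotropic quadratic in the quadratic extension of `F` are not in `F`
and are swapped by the Frobenius. -/
theorem conjugate_root {F K : Type*} [Field F] [Field K] [Algebra F K]
    [Fintype F] {t n : F}
    (hirr : ∀ u v : F, u ^ 2 + t * u * v + n * v ^ 2 = 0 → u = 0 ∧ v = 0)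
    {α : K} (hα : α ^ 2 + algebraMap F K t * α + algebraMap F K n = 0) :
    (∀ a : F, algebraMap F K a ≠ α) ∧
    α ^ Fintype.card F ≠ α ∧ α + α ^ Fintype.card F = - algebraMap F K t ∧
    α * α ^ Fintype.card F = algebraMap F K n := by
  have hnot : ∀ a : F, algebraMap F K a ≠ α := by
    rintro a rfl
    have : a ^ 2 + t * a * 1 + n * 1 ^ 2 = 0 := by
      apply (algebraMap F K).injective
      simpa using hα
    simpa using hirr a 1 this
  have h1 := congrArg (FiniteField.frobeniusAlgHom F K) hα
  rw [map_add, map_add, map_mul, map_pow, AlgHom.commutes, AlgHom.commutes, map_zero,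
    FiniteField.frobeniusAlgHom_apply] at h1
  set β := α ^ Fintype.card F with hβ
  have hne : β - α ≠ 0 := by
    intro h0
    have h2 : α ^ Fintype.card F = α := sub_eq_zero.1 h0
    exact hnot _ (exists_algebraMap_eq_of_pow_card_eq_self h2).choose_spec
  have hs : α + β = - algebraMap F K t := by
    apply mul_left_cancel₀ hne
    linear_combination h1 - hα
  exact ⟨hnot, sub_ne_zero.1 hne, hs, by linear_combination α * hs - hα⟩

theorem span_pow_bihomogeneous {K A : Type*} [Field K] [CommRing A] [Algebra K A]
    (x y : A) (q s : ℕ) :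
    (Submodule.span K {x ^ (1 + q), x ^ q * y, x * y ^ q, y ^ (1 + q)}) ^ s =
      Submodule.span K {v | ∃ i j : ℕ, i ≤ s ∧ j ≤ s ∧
        v = x ^ (i + q * j) * y ^ ((s - i) + q * (s - j))} := by
  induction s with
  | zero =>
    rw [pow_zero, Submodule.one_eq_span]
    congr 1
    ext v
    simp
  | succ s ih =>
    rw [pow_succ, ih, Submodule.span_mul_span]
    apply le_antisymm
    · apply Submodule.span_mono
      rintro _ ⟨_, ⟨i, j, hi, hj, rfl⟩, w, hw, rfl⟩
      obtain ⟨a, ha⟩ := Nat.exists_eq_add_of_le hi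
      obtain ⟨b, hb⟩ := Nat.exists_eq_add_of_le hj
      obtain rfl | rfl | rfl | rfl := hw
      · refine ⟨i + 1, j + 1, by omega, by omega, ?_⟩
        rw [show s - i = a by omega, show s - j = b by omega,
          show s + 1 - (i + 1) = a by omega, show s + 1 - (j + 1) = b by omega]
        ring
      · refine ⟨i, j + 1, by omega, by omega, ?_⟩
        rw [show s - i = a by omega, show s - j = b by omega,
          show s + 1 - i = a + 1 by omega, show s + 1 - (j + 1) = b by omega]
        ring
      · refine ⟨i + 1, j, by omega, by omega, ?_⟩
        rw [show s - i = a by omega, show s - j = b by omega,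
          show s + 1 - (i + 1) = a by omega, show s + 1 - j = b + 1 by omega]
        ring
      · refine ⟨i, j, by omega, by omega, ?_⟩
        rw [show s - i = a by omega, show s - j = b by omega,
          show s + 1 - i = a + 1 by omega, show s + 1 - j = b + 1 by omega]
        ring
    · apply Submodule.span_mono
      rintro _ ⟨i, j, hi, hj, rfl⟩
      obtain rfl | hi := Nat.le_succ_iff_eq_or_le.1 hi <;>
      obtain rfl | hj := Nat.le_succ_iff_eq_or_le.1 hj
      · exact ⟨_, ⟨s, s, le_rfl, le_rfl, rfl⟩, x ^ (1 + q), by simp, by simp; ring⟩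
      · refine ⟨_, ⟨s, j, le_rfl, hj, rfl⟩, x * y ^ q, by simp, ?_⟩
        obtain ⟨b, hb⟩ := Nat.exists_eq_add_of_le hj
        simp only [Nat.succ_eq_add_one]
        rw [show s - j = b by omega, show s + 1 - j = b + 1 by omega, Nat.sub_self, Nat.sub_self]
        ring
      · refine ⟨_, ⟨i, s, hi, le_rfl, rfl⟩, x ^ q * y, by simp, ?_⟩
        obtain ⟨a, ha⟩ := Nat.exists_eq_add_of_le hi
        simp only [Nat.succ_eq_add_one]
        rw [show s - i = a by omega, show s + 1 - i = a + 1 by omega, Nat.sub_self, Nat.sub_self]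
        ring
      · refine ⟨_, ⟨i, j, hi, hj, rfl⟩, y ^ (1 + q), by simp, ?_⟩
        obtain ⟨a, ha⟩ := Nat.exists_eq_add_of_le hi
        obtain ⟨b, hb⟩ := Nat.exists_eq_add_of_le hj
        simp only
        rw [show s - i = a by omega, show s - j = b by omega,
          show s + 1 - i = a + 1 by omega, show s + 1 - j = b + 1 by omega]
        ring

theorem mem_span_iff_of_forall_mem_range {F K ι : Type*} [Field F] [Field K] [Algebra F K]
    {T : Set (ι → K)} (hT : ∀ v ∈ T, ∀ o, v o ∈ (algebraMap F K).range) (v : ι → K) :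
    v ∈ Submodule.span F T ↔
      v ∈ Submodule.span K T ∧ ∀ o, v o ∈ (algebraMap F K).range := by
  constructor
  · intro hv
    refine ⟨Submodule.span_subset_span F K T hv, ?_⟩
    induction hv using Submodule.span_induction with
    | mem v hv => exact hT v hv
    | zero => exact fun o => zero_mem _
    | add v w _ _ hv hw => exact fun o => add_mem (hv o) (hw o)
    | smul a v _ hv =>
      intro o
      rw [Pi.smul_apply, Algebra.smul_def]
      exact mul_mem ⟨a, rfl⟩ (hv o)
  · rintro ⟨hv, hvF⟩
    obtain ⟨ρ, hρ⟩ := (Algebra.linearMap F K).exists_leftInverse_of_injective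
      (LinearMap.ker_eq_bot.2 (algebraMap F K).injective)
    replace hρ (a : F) : ρ (algebraMap F K a) = a := LinearMap.congr_fun hρ a
    have key : ∀ k : K, (fun o => algebraMap F K (ρ (k * v o))) ∈ Submodule.span F T := by
      clear hvF
      induction hv using Submodule.span_induction with
      | mem v hv =>
        intro k
        convert Submodule.smul_mem _ (ρ k) (Submodule.subset_span hv) using 1
        ext o
        obtain ⟨a, ha⟩ := hT v hv o
        rw [Pi.smul_apply, ← ha, mul_comm, ← Algebra.smul_def, map_smul, smul_eq_mul, map_mul,
          Algebra.smul_def, mul_comm]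
      | zero => intro k; convert Submodule.zero_mem _; simp
      | add v w _ _ hv hw =>
        intro k
        convert add_mem (hv k) (hw k) using 1
        ext o
        simp [mul_add]
      | smul a v _ hv =>
        intro k
        convert hv (k * a) using 3
        simp [mul_assoc]
    convert key 1 using 1
    ext o
    obtain ⟨a, ha⟩ := hvF o
    rw [one_mul, ← ha, hρ]

theorem finrank_span_eq_of_forall_mem_range {F K ι : Type*} [Field F] [Field K] [Algebra F K]
    [Module.Finite F K] [Finite ι]
    {T : Set (ι → K)} (hT : ∀ v ∈ T, ∀ o, v o ∈ (algebraMap F K).range) :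
    Module.finrank F (Submodule.span F T) = Module.finrank K (Submodule.span K T) := by
  set N := Submodule.span F T with hN
  let b := Module.finBasis F N
  have hspan : Submodule.span K (Set.range fun i => (b i : ι → K)) = Submodule.span K T := by
    have h1 : Submodule.span F (Set.range fun i => (b i : ι → K)) = N := by
      have := congrArg (Submodule.map N.subtype) b.span_eq
      rwa [Submodule.map_span, ← Set.range_comp, Submodule.map_top,
        Submodule.range_subtype] at this
    rw [← Submodule.span_span_of_tower F, h1, hN, Submodule.span_span_of_tower]
  have hli : LinearIndependent K fun i => (b i : ι → K) := by
    rw [Fintype.linearIndependent_iff]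
    intro g hg i
    rw [← Module.forall_dual_apply_eq_zero_iff F]
    intro ρ
    have hb := Fintype.linearIndependent_iff.1 b.linearIndependent (fun j => ρ (g j))
    refine hb ?_ i
    ext o
    have ho := congrFun hg o
    have hr : ∀ j, ∃ a, algebraMap F K a = (b j : ι → K) o := fun j =>
      ((mem_span_iff_of_forall_mem_range hT _).1 (b j).2).2 o
    choose a ha using hr
    simp only [Finset.sum_apply, Pi.smul_apply, smul_eq_mul, Pi.zero_apply, ← ha] at ho
    have hρ := congrArg ρ ho
    simp only [map_sum, map_zero, mul_comm (g _), ← Algebra.smul_def, map_smul, smul_eq_mul] at hρ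
    calc N.subtype (∑ j, ρ (g j) • b j) o = algebraMap F K (∑ j, a j * ρ (g j)) := by
          rw [map_sum, Finset.sum_apply, map_sum]
          refine Finset.sum_congr rfl fun j _ => ?_
          rw [map_smul, Pi.smul_apply, Submodule.subtype_apply, ← ha, Algebra.smul_def, map_mul,
            mul_comm]
      _ = 0 := by rw [hρ, map_zero]
  rw [← hspan, finrank_span_eq_card hli, Fintype.card_fin]

/-- The first homogeneous coordinate on the projective line. -/
def projX (K : Type*) [Field K] (o : Option K) : K := (o.elim ((0 : K), (1 : K)) fun x => (1, x)).1

/-- The second homogeneous coordinate on the projective line. -/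
def projY (K : Type*) [Field K] (o : Option K) : K := (o.elim ((0 : K), (1 : K)) fun x => (1, x)).2

@[simp] theorem projX_none (K : Type*) [Field K] : projX K none = 0 := rfl
@[simp] theorem projX_some {K : Type*} [Field K] (y : K) : projX K (some y) = 1 := rfl
@[simp] theorem projY_none (K : Type*) [Field K] : projY K none = 1 := rfl
@[simp] theorem projY_some {K : Type*} [Field K] (y : K) : projY K (some y) = y := rfl

/-- The code over `K` spanned by the bihomogeneous monomials of bidegree `(s, s)` in the
coordinates of the projective line and their `q`-th powers. -/
def bihomogeneousCode (K : Type*) [Field K] (q s : ℕ) : Submodule K (Option K → K) :=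
  Submodule.span K {v | ∃ i j : ℕ, i ≤ s ∧ j ≤ s ∧
    v = projX K ^ (i + q * j) * projY K ^ ((s - i) + q * (s - j))}

theorem exists_polynomial_of_mem_bihomogeneousCode {K : Type*} [Field K] {q s : ℕ}
    {v : Option K → K} (hv : v ∈ bihomogeneousCode K q s) :
    ∃ P : Polynomial K, P.natDegree ≤ s * (q + 1) ∧ (∀ y, v (some y) = P.eval y) ∧
      v none = P.coeff (s * (q + 1)) := by
  induction hv using Submodule.span_induction with
  | mem v hv =>
    obtain ⟨i, j, hi, hj, rfl⟩ := hv
    obtain ⟨a, rfl⟩ := Nat.exists_eq_add_of_le hi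
    obtain ⟨b, hb⟩ := Nat.exists_eq_add_of_le hj
    refine ⟨Polynomial.X ^ ((i + a - i) + q * (i + a - j)), ?_, fun y => by simp, ?_⟩
    · rw [Polynomial.natDegree_X_pow, hb, Nat.add_sub_cancel_left, ← hb, Nat.add_sub_cancel_left]
      nlinarith
    · rw [Polynomial.coeff_X_pow]
      have : (i + a) * (q + 1) = (i + a - i + q * (i + a - j)) ↔ i + q * j = 0 := by
        rw [Nat.add_sub_cancel_left, hb, Nat.add_sub_cancel_left, ← hb]
        have : (i + a) * (q + 1) = (a + q * b) + (i + q * j) := by rw [mul_add, mul_comm, hb]; grind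
        omega
      simp only [this, Pi.mul_apply, Pi.pow_apply, projX_none, projY_none, one_pow, mul_one,
        zero_pow_eq]
  | zero => exact ⟨0, by simp⟩
  | add v w _ _ hv hw =>
    obtain ⟨P, hP, hPv, hP0⟩ := hv
    obtain ⟨R, hR, hRv, hR0⟩ := hw
    exact ⟨P + R, Polynomial.natDegree_add_le_of_degree_le hP hR, by simp [hPv, hRv],
      by simp [hP0, hR0]⟩
  | smul a v _ hv =>
    obtain ⟨P, hP, hPv, hP0⟩ := hv
    exact ⟨a • P, (Polynomial.natDegree_smul_le a P).trans hP, by simp [hPv], by simp [hP0]⟩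

theorem card_filter_option {α : Type*} [Fintype α] (p : Option α → Prop) [DecidablePred p] :
    (Finset.univ.filter p).card =
      (if p none then 1 else 0) + (Finset.univ.filter fun a => p (some a)).card := by
  simp only [Finset.card_filter, Fintype.sum_option]

theorem card_zeros_le_of_mem_bihomogeneousCode {K : Type*} [Field K] [Fintype K] [DecidableEq K]
    {q s : ℕ} {v : Option K → K} (hv : v ∈ bihomogeneousCode K q s) (hv0 : v ≠ 0) :
    (Finset.univ.filter fun o => v o = 0).card ≤ s * (q + 1) := by
  obtain ⟨P, hP, hPv, hP0⟩ := exists_polynomial_of_mem_bihomogeneousCode hv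
  have hP_ne : P ≠ 0 := by
    rintro rfl
    refine hv0 (funext fun o => ?_)
    cases o <;> simp [hPv, hP0]
  have hroots : (Finset.univ.filter fun y => v (some y) = 0).card ≤ P.natDegree := by
    refine le_trans ?_ (P.roots.toFinset_card_le.trans P.card_roots')
    refine Finset.card_le_card fun y hy => ?_
    simpa [hP_ne, hPv] using hy
  rw [card_filter_option]
  split_ifs with h0
  · have : P.natDegree ≠ s * (q + 1) := fun h => hP_ne <| by
      rwa [hP0, ← h, Polynomial.coeff_natDegree, Polynomial.leadingCoeff_eq_zero] at h0
    omega
  · omega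

theorem finrank_bihomogeneousCode {K : Type*} [Field K] [Fintype K]
    {q s : ℕ} (hK : Fintype.card K = q ^ 2) (hs : s + 1 < q) :
    Module.finrank K (bihomogeneousCode K q s) = (s + 1) ^ 2 := by
  let g : Fin (s + 1) × Fin (s + 1) → Option K → K := fun a =>
    projX K ^ ((a.1 : ℕ) + q * a.2) * projY K ^ ((s - a.1) + q * (s - a.2))
  have hg : bihomogeneousCode K q s = Submodule.span K (Set.range g) := by
    rw [bihomogeneousCode]
    congr 1
    ext v
    constructor
    · rintro ⟨i, j, hi, hj, rfl⟩
      exact ⟨(⟨i, by omega⟩, ⟨j, by omega⟩), rfl⟩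
    · rintro ⟨⟨i, j⟩, rfl⟩
      exact ⟨i, j, by omega, by omega, rfl⟩
  have hinj : Function.Injective
      fun a : Fin (s + 1) × Fin (s + 1) => (s - (a.1 : ℕ)) + q * (s - (a.2 : ℕ)) := by
    rintro ⟨i, j⟩ ⟨i', j'⟩ h
    have h1 := congrArg (· % q) h
    have h2 := congrArg (· / q) h
    simp only [Nat.add_mul_mod_self_left, Nat.add_mul_div_left _ _ (show 0 < q by omega)] at h1 h2
    rw [Nat.mod_eq_of_lt (by omega), Nat.mod_eq_of_lt (by omega)] at h1
    rw [Nat.div_eq_of_lt (by omega), Nat.div_eq_of_lt (by omega)] at h2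
    ext <;> simp only <;> omega
  have hli : LinearIndependent K g := by
    rw [Fintype.linearIndependent_iff]
    intro c hc a
    set P : Polynomial K := ∑ a : Fin (s + 1) × Fin (s + 1),
      Polynomial.monomial ((s - (a.1 : ℕ)) + q * (s - (a.2 : ℕ))) (c a) with hP
    have hP0 : P = 0 := by
      refine Polynomial.eq_zero_of_natDegree_lt_card_of_eval_eq_zero P Function.injective_id
        (fun y => ?_) ?_
      · have := congrFun hc (some y)
        simpa [g, hP, Polynomial.eval_finsetSum] using this
      · rw [hK]
        refine lt_of_le_of_lt (Polynomial.natDegree_sum_le_of_forall_le (n := s + q * s) _ _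
          fun a _ => (Polynomial.natDegree_monomial_le _).trans ?_) ?_
        · gcongr <;> omega
        · nlinarith
    have := congrArg (Polynomial.coeff · ((s - (a.1 : ℕ)) + q * (s - (a.2 : ℕ)))) hP0
    simp only [hP, Polynomial.finsetSum_coeff, Polynomial.coeff_monomial,
      Polynomial.coeff_zero] at this
    rw [Finset.sum_eq_single a] at this
    · simpa using this
    · intro b _ hb
      exact if_neg fun h => hb (hinj h)
    · simp
  rw [hg, finrank_span_eq_card hli]
  simp [sq]

theorem card_pow_card_add_one_eq {F K : Type*} [Field F] [Field K] [Algebra F K]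
    [Fintype F] [Fintype K] [DecidableEq F] [DecidableEq K]
    (hK : Fintype.card K = Fintype.card F ^ 2)
    {ν : K → F} (hν : ∀ y, algebraMap F K (ν y) = y ^ (1 + Fintype.card F)) {a : F} (ha : a ≠ 0) :
    (Finset.univ.filter fun y => ν y = a).card = Fintype.card F + 1 := by
  have hν0 (y : K) : ν y ≠ 0 ↔ y ≠ 0 := by
    rw [← map_ne_zero (algebraMap F K), hν]
    simp
  have hle : ∀ a ∈ Finset.univ.erase (0 : F),
      (Finset.univ.filter fun y => ν y = a).card ≤ Fintype.card F + 1 := by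
    intro a _
    refine le_trans (Finset.card_le_card fun y hy => ?_)
      ((Polynomial.nthRoots (Fintype.card F + 1) (algebraMap F K a)).toFinset_card_le.trans
        (Polynomial.card_nthRoots _ _))
    rw [Multiset.mem_toFinset, Polynomial.mem_nthRoots (by omega), add_comm, ← hν,
      (Finset.mem_filter.1 hy).2]
  refine (Finset.sum_eq_sum_iff_of_le hle).1 ?_ a (by simpa using ha)
  have hf : (Finset.univ.filter fun y => ν y ∈ Finset.univ.erase 0) = Finset.univ.erase 0 := by
    ext y
    simp [hν0]
  rw [Finset.sum_card_fiberwise_eq_card_filter, hf, Finset.card_erase_of_mem (Finset.mem_univ _),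
    Finset.sum_const, Finset.card_erase_of_mem (Finset.mem_univ _), Finset.card_univ,
    Finset.card_univ, hK, smul_eq_mul, mul_comm, ← Nat.sq_sub_sq, one_pow]

/-- The normalized rational points of the quadric `x₀x₃ = x₁² + t x₁x₂ + n x₂²`. -/
def quadricPoints {F : Type*} [Field F] (t n : F) : Set (Fin 4 → F) :=
  {p | (∃ i, p i = 1 ∧ ∀ j < i, p j = 0) ∧
    p 0 * p 3 = p 1 ^ 2 + t * p 1 * p 2 + n * p 2 ^ 2}

/-- Normalized homogeneous coordinates on the quadric: the point at infinity, and the affine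
points parametrized by `F × F`. -/
def quadricCoord {F K : Type*} [Field F] (t n : F) (z : K → F × F) (o : Option K) : Fin 4 → F :=
  o.elim ![0, 0, 0, 1] fun y => ![1, (z y).1, (z y).2,
    (z y).1 ^ 2 + t * (z y).1 * (z y).2 + n * (z y).2 ^ 2]

theorem quadricCoord_mem {F K : Type*} [Field F] (t n : F) (z : K → F × F) (o : Option K) :
    quadricCoord t n z o ∈ quadricPoints t n := by
  cases o with
  | none =>
    refine ⟨⟨3, rfl, fun j hj => ?_⟩, by simp [quadricCoord]⟩
    fin_cases j <;> simp_all [quadricCoord]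
  | some y => exact ⟨⟨0, rfl, by simp⟩, by simp [quadricCoord]⟩

theorem quadricCoord_injective {F K : Type*} [Field F] (t n : F) {z : K → F × F}
    (hz : Function.Injective z) : Function.Injective (quadricCoord t n z) := by
  rintro (_ | y) (_ | y') h
  · rfl
  · simpa [quadricCoord] using congrFun h 0
  · simpa [quadricCoord] using congrFun h 0
  · have h1 : (z y).1 = (z y').1 := congrFun h 1
    have h2 : (z y).2 = (z y').2 := congrFun h 2
    exact congrArg some (hz (Prod.ext h1 h2))

theorem exists_quadricCoord_eq {F K : Type*} [Field F] {t n : F} {z : K → F × F}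
    (hz : Function.Surjective z)
    (hirr : ∀ u v : F, u ^ 2 + t * u * v + n * v ^ 2 = 0 → u = 0 ∧ v = 0)
    {p : Fin 4 → F} (hp : p ∈ quadricPoints t n) : ∃ o, quadricCoord t n z o = p := by
  obtain ⟨⟨i, hi, hlt⟩, hp⟩ := hp
  by_cases h0 : p 0 = 0
  · obtain ⟨h1, h2⟩ := hirr (p 1) (p 2) (by rw [← hp, h0, zero_mul])
    have hi3 : i = 3 := by
      by_contra hne
      have : p i = 0 := by
        fin_cases i
        exacts [h0, h1, h2, absurd rfl hne]
      exact one_ne_zero (hi.symm.trans this)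
    rw [hi3] at hi
    refine ⟨none, funext fun j => ?_⟩
    fin_cases j
    exacts [h0.symm, h1.symm, h2.symm, hi.symm]
  · have hi0 : i = 0 := by
      by_contra hne0
      exact h0 (hlt 0 (Fin.pos_iff_ne_zero.2 hne0))
    subst hi0
    obtain ⟨y, hy⟩ := hz (p 1, p 2)
    rw [hi, one_mul] at hp
    refine ⟨some y, funext fun j => ?_⟩
    fin_cases j
    · exact hi.symm
    · exact congrArg Prod.fst hy
    · exact congrArg Prod.snd hy
    · exact (by rw [hp, hy] :
        (z y).1 ^ 2 + t * (z y).1 * (z y).2 + n * (z y).2 ^ 2 = p 3)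

theorem exists_quadric_equiv {F K : Type*} [Field F] [Field K] [Algebra F K] [Fintype F]
    [Fintype K] (hK : Fintype.card K = Fintype.card F ^ 2) {t n : F}
    (hirr : ∀ u v : F, u ^ 2 + t * u * v + n * v ^ 2 = 0 → u = 0 ∧ v = 0)
    {α : K} (hα : α ^ 2 + algebraMap F K t * α + algebraMap F K n = 0) :
    ∃ e : quadricPoints t n ≃ Option K,
      ∀ o, algebraMap F K ((e.symm o).1 0) = projX K o ^ (1 + Fintype.card F) ∧
        algebraMap F K ((e.symm o).1 1) - α * algebraMap F K ((e.symm o).1 2) =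
          projX K o ^ Fintype.card F * projY K o ∧
        algebraMap F K ((e.symm o).1 1) - α ^ Fintype.card F * algebraMap F K ((e.symm o).1 2) =
          projX K o * projY K o ^ Fintype.card F ∧
        algebraMap F K ((e.symm o).1 3) = projY K o ^ (1 + Fintype.card F) := by
  obtain ⟨hnot, hne, hadd, hmul⟩ := conjugate_root hirr hα
  have hinj : Function.Injective fun z : F × F => algebraMap F K z.1 - α * algebraMap F K z.2 := by
    rintro ⟨a, b⟩ ⟨c, d⟩ h
    simp only at h
    have hbd : b = d := by
      by_contra hbd
      have hsub : algebraMap F K b - algebraMap F K d ≠ 0 :=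
        sub_ne_zero.2 fun h' => hbd ((algebraMap F K).injective h')
      refine hnot ((a - c) / (b - d)) ?_
      rw [map_div₀, map_sub, map_sub, div_eq_iff hsub]
      linear_combination h
    subst hbd
    exact Prod.ext ((algebraMap F K).injective (by linear_combination h)) rfl
  have hbij := (Fintype.bijective_iff_injective_and_card _).2
    ⟨hinj, by rw [Fintype.card_prod, hK, sq]⟩
  obtain ⟨z, hz⟩ : ∃ z : K ≃ F × F,
      ∀ y, algebraMap F K (z y).1 - α * algebraMap F K (z y).2 = y :=
    ⟨(Equiv.ofBijective _ hbij).symm, (Equiv.ofBijective _ hbij).apply_symm_apply⟩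
  have hzq (y : K) : algebraMap F K (z y).1 - α ^ Fintype.card F * algebraMap F K (z y).2 =
      y ^ Fintype.card F := by
    have := congrArg (FiniteField.frobeniusAlgHom F K) (hz y)
    rwa [map_sub, map_mul, AlgHom.commutes, AlgHom.commutes, FiniteField.frobeniusAlgHom_apply,
      FiniteField.frobeniusAlgHom_apply] at this
  have hg : Function.Bijective
      fun o => (⟨quadricCoord t n z o, quadricCoord_mem t n z o⟩ : quadricPoints t n) := by
    refine ⟨fun o o' h => quadricCoord_injective t n z.injective (congrArg Subtype.val h), ?_⟩
    rintro ⟨p, hp⟩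
    obtain ⟨o, ho⟩ := exists_quadricCoord_eq z.surjective hirr hp
    exact ⟨o, Subtype.ext ho⟩
  refine ⟨(Equiv.ofBijective _ hg).symm, fun o => ?_⟩
  have hq : Fintype.card F ≠ 0 := Fintype.card_ne_zero
  rw [Equiv.symm_symm, Equiv.ofBijective_apply]
  cases o with
  | none => simp [quadricCoord, hq]
  | some y =>
    refine ⟨by simp [quadricCoord], by simpa [quadricCoord] using hz y,
      by simpa [quadricCoord] using hzq y, ?_⟩
    have hcoord : quadricCoord t n z (some y) 3 =
      (z y).1 ^ 2 + t * (z y).1 * (z y).2 + n * (z y).2 ^ 2 := rfl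
    simp only [hcoord]
    rw [projY_some, pow_add, pow_one, map_add, map_add, map_mul, map_mul, map_mul,
      map_pow, map_pow]
    linear_combination
      (algebraMap F K (z y).1 - α ^ Fintype.card F * algebraMap F K (z y).2) * hz y + y * hzq y
      + hadd * algebraMap F K (z y).1 * algebraMap F K (z y).2
      - hmul * algebraMap F K (z y).2 ^ 2

/-- The coordinates of the quadric span over `K` the same functions on the projective line as the
monomials of bidegree `(1, 1)`. -/
theorem span_range_coord_eq {K ι : Type*} [Field K] {α β : K} (hne : β ≠ α)
    {X : Fin 4 → ι → K} {a b c d : ι → K} (h0 : X 0 = a) (h1 : X 1 - α • X 2 = b)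
    (h2 : X 1 - β • X 2 = c) (h3 : X 3 = d) :
    Submodule.span K (Set.range X) = Submodule.span K {a, b, c, d} := by
  subst h0 h1 h2 h3
  have hX (i) : X i ∈ Submodule.span K (Set.range X) := Submodule.subset_span ⟨i, rfl⟩
  apply le_antisymm <;> rw [Submodule.span_le]
  · set S := Submodule.span K {X 0, X 1 - α • X 2, X 1 - β • X 2, X 3}
    have hb : X 1 - α • X 2 ∈ S := Submodule.subset_span (by simp)
    have hc : X 1 - β • X 2 ∈ S := Submodule.subset_span (by simp)
    have hX2 : X 2 ∈ S := by
      have := S.smul_mem (β - α)⁻¹ (S.sub_mem hb hc)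
      rwa [sub_sub_sub_cancel_left, ← sub_smul, smul_smul,
        inv_mul_cancel₀ (sub_ne_zero.2 hne), one_smul] at this
    rintro _ ⟨i, rfl⟩
    fin_cases i
    · exact Submodule.subset_span (by simp)
    · have := S.add_mem hb (S.smul_mem α hX2)
      rwa [sub_add_cancel] at this
    · exact hX2
    · exact Submodule.subset_span (by simp)
  · rintro _ (rfl | rfl | rfl | rfl)
    · exact hX 0
    · exact sub_mem (hX 1) (Submodule.smul_mem _ _ (hX 2))
    · exact sub_mem (hX 1) (Submodule.smul_mem _ _ (hX 2))
    · exact hX 3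

open scoped Pointwise in
/-- Evaluating homogeneous forms of degree `s` gives the `s`-th power of the span of the
coordinate functions. -/
theorem map_homogeneousSubmodule_eq_span_pow {F σ A : Type*} [Field F] [CommRing A] [Algebra F A]
    (g : MvPolynomial σ F →ₐ[F] A) (s : ℕ) :
    (MvPolynomial.homogeneousSubmodule σ F s).map g.toLinearMap =
      Submodule.span F (Set.range (g ∘ MvPolynomial.X) ^ s) := by
  rw [← MvPolynomial.homogeneousSubmodule_one_pow, Submodule.map_pow,
    MvPolynomial.homogeneousSubmodule_one_eq_span_X, Submodule.map_span, ← Set.range_comp,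
    Submodule.span_pow]
  rfl


/-- For `0 ≤ s < q-1`, the evaluation code `C_E(s)` on the elliptic quadric
`E : x₀x₃ = Q(x₁,x₂)` over `F_q` (with `Q` an irreducible quadratic form) has length
`q²+1`, dimension `(s+1)²` and minimum distance `q²+1-s(q+1)`; moreover it is
permutation equivalent to the extended BCH code `B₀^{ext}(s)`. -/
theorem stmt_14 (F K : Type) [Field F] [Field K] [Algebra F K]
    [Fintype F] [Fintype K] [DecidableEq K] (q s : ℕ)
    (hqF : Fintype.card F = q) (hqK : Fintype.card K = q ^ 2) (hs : s + 1 < q)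
    (t n : F)
    -- Q(x,y) = x² + t·x·y + n·y² is irreducible (anisotropic) over F_q
    (hirr : ∀ u v : F, u ^ 2 + t * u * v + n * v ^ 2 = 0 → u = 0 ∧ v = 0) :
    -- rational points of E, with normalized coordinates
    let Epts : Set (Fin 4 → F) := {p | (∃ i, p i = 1 ∧ ∀ j < i, p j = 0) ∧
      p 0 * p 3 = p 1 ^ 2 + t * p 1 * p 2 + n * p 2 ^ 2}
    -- the evaluation code C_E(s)
    let CE : Submodule F (Epts → F) := Submodule.span F
      {w | ∃ f : MvPolynomial (Fin 4) F, f.IsHomogeneous s ∧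
        w = fun p : Epts => MvPolynomial.eval p.1 f}
    let wt : (Epts → F) → ℕ := fun c => {p | c p ≠ 0}.ncard
    -- the extended BCH code B₀^{ext}(s)
    let pt : Option K → K × K := fun o => o.elim (0, 1) fun x => (1, x)
    let Bext : Submodule K (Option K → K) := Submodule.span K
      {v | ∃ i j : ℕ, i ≤ s ∧ j ≤ s ∧
        v = fun p => (pt p).1 ^ (i + q * j) * (pt p).2 ^ ((s - i) + q * (s - j))}
    let B₀ : Submodule F (Option K → K) := Bext.restrictScalars F ⊓
      Submodule.pi Set.univ fun _ => LinearMap.range (Algebra.linearMap F K)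
    Epts.ncard = q ^ 2 + 1 ∧
    Module.finrank F CE = (s + 1) ^ 2 ∧
    (∃ c ∈ CE, c ≠ 0 ∧ wt c = q ^ 2 + 1 - s * (q + 1)) ∧
    (∀ c ∈ CE, c ≠ 0 → q ^ 2 + 1 - s * (q + 1) ≤ wt c) ∧
    -- permutation equivalence with the extended BCH code
    (∃ e : Epts ≃ Option K, ∀ v : Option K → K,
      v ∈ B₀ ↔ ∃ c ∈ CE, v = fun p => algebraMap F K (c (e.symm p))) := by
  classical
  intro Epts CE wt pt Bext B₀
  subst hqF
  have hfin : Module.finrank F K = 2 := by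
    have := Module.card_eq_pow_finrank (K := F) (V := K)
    exact (Nat.pow_right_injective (by omega) (hqK.symm.trans this)).symm
  obtain ⟨α, hα⟩ := exists_root_of_finrank_eq_two hfin hirr
  obtain ⟨-, hne, -, -⟩ := conjugate_root hirr hα
  obtain ⟨e, he⟩ : ∃ e : Epts ≃ Option K, ∀ o,
      algebraMap F K ((e.symm o).1 0) = projX K o ^ (1 + Fintype.card F) ∧
      algebraMap F K ((e.symm o).1 1) - α * algebraMap F K ((e.symm o).1 2) =
        projX K o ^ Fintype.card F * projY K o ∧
      algebraMap F K ((e.symm o).1 1) - α ^ Fintype.card F * algebraMap F K ((e.symm o).1 2) =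
        projX K o * projY K o ^ Fintype.card F ∧
      algebraMap F K ((e.symm o).1 3) = projY K o ^ (1 + Fintype.card F) :=
    exists_quadric_equiv hqK hirr hα
  let ev : MvPolynomial (Fin 4) F →ₐ[F] (Epts → F) :=
    AlgHom.pi fun p => MvPolynomial.aeval p.1
  let ψ : (Epts → F) →ₐ[F] (Option K → K) :=
    AlgHom.pi fun o => (Algebra.ofId F K).comp (Pi.evalAlgHom F _ (e.symm o))
  have hψ (c : Epts → F) (o : Option K) : ψ c o = algebraMap F K (c (e.symm o)) := rfl
  have hψinj : Function.Injective ψ := fun c c' h => funext fun p => by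
    have := congrFun h (e p)
    rw [hψ, hψ, Equiv.symm_apply_apply] at this
    exact (algebraMap F K).injective this
  have hCE : CE = (MvPolynomial.homogeneousSubmodule (Fin 4) F s).map ev.toLinearMap := by
    rw [← Submodule.span_eq (Submodule.map _ _)]
    refine congrArg (Submodule.span F) (Set.ext fun w => ?_)
    constructor
    · rintro ⟨f, hf, rfl⟩
      exact ⟨f, hf, rfl⟩
    · rintro ⟨f, hf, rfl⟩
      exact ⟨f, hf, rfl⟩
  set X : Fin 4 → Option K → K := (ψ.comp ev) ∘ MvPolynomial.X with hX
  have hXapply (i : Fin 4) (o : Option K) : X i o = algebraMap F K ((e.symm o).1 i) := by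
    change algebraMap F K (MvPolynomial.aeval (e.symm o).1 (MvPolynomial.X i)) = _
    rw [MvPolynomial.aeval_X]
  obtain ⟨T, hT⟩ : ∃ T : Set (Option K → K),
      T = open scoped Pointwise in Set.range X ^ s := ⟨_, rfl⟩
  have hmap : CE.map ψ.toLinearMap = Submodule.span F (T) := by
    rw [hCE, ← Submodule.map_comp, hT, hX, ← map_homogeneousSubmodule_eq_span_pow]
    rfl
  have hspan : Submodule.span K (T) = bihomogeneousCode K (Fintype.card F) s := by
    rw [hT, bihomogeneousCode, ← span_pow_bihomogeneous, ← Submodule.span_pow,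
      span_range_coord_eq hne]
    · ext o; rw [hXapply]; exact (he o).1
    · ext o; simp only [Pi.sub_apply, Pi.smul_apply, hXapply]; exact (he o).2.1
    · ext o; simp only [Pi.sub_apply, Pi.smul_apply, hXapply]; exact (he o).2.2.1
    · ext o; rw [hXapply]; exact (he o).2.2.2
  have hrange : ∀ v ∈ T, ∀ o, v o ∈ (algebraMap F K).range := by
    intro v hv o
    have hv' : v ∈ CE.map ψ.toLinearMap := hmap ▸ Submodule.subset_span hv
    obtain ⟨c, -, rfl⟩ := hv'
    exact ⟨c (e.symm o), rfl⟩
  have hmem (c) (hc : c ∈ CE) : ψ c ∈ bihomogeneousCode K (Fintype.card F) s := by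
    rw [← hspan]
    refine ((mem_span_iff_of_forall_mem_range hrange _).1 ?_).1
    rw [← hmap]
    exact ⟨c, hc, rfl⟩
  have hwt (c : Epts → F) : wt c = Fintype.card F ^ 2 + 1 -
      (Finset.univ.filter fun o => ψ c o = 0).card := by
    have h1 : wt c = (Finset.univ.filter fun o => ¬ ψ c o = 0).card := by
      rw [← Set.ncard_coe_finset]
      refine Set.ncard_congr (fun p _ => e p) (fun p hp => ?_) (fun p p' _ _ h => e.injective h)
        fun o ho => ⟨e.symm o, ?_, e.apply_symm_apply o⟩
      · simpa [hψ] using hp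
      · change c (e.symm o) ≠ 0
        simpa [hψ] using ho
    have h2 := Finset.card_filter_add_card_filter_not (s := Finset.univ) fun o => ψ c o = 0
    rw [Finset.card_univ, Fintype.card_option, hqK] at h2
    omega
  refine ⟨?_, ?_, ?_, ?_, e, fun v => ?_⟩
  · rw [← Nat.card_coe_set_eq, Nat.card_congr (show Epts ≃ Option K from e),
      Nat.card_eq_fintype_card, Fintype.card_option, hqK]
  · rw [(Submodule.equivMapOfInjective ψ.toLinearMap hψinj CE).finrank_eq, hmap,
      finrank_span_eq_of_forall_mem_range hrange, hspan, finrank_bihomogeneousCode hqK hs]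
  · obtain ⟨S, hS, hScard⟩ : ∃ S ⊆ Finset.univ.erase (0 : F), S.card = s :=
      Finset.exists_subset_card_eq (by
        rw [Finset.card_erase_of_mem (Finset.mem_univ _), Finset.card_univ]; omega)
    let f : MvPolynomial (Fin 4) F :=
      ∏ a ∈ S, (MvPolynomial.X 3 - MvPolynomial.C a * MvPolynomial.X 0)
    have hf : f.IsHomogeneous s := by
      have := MvPolynomial.IsHomogeneous.prod S
        (fun a => (MvPolynomial.X 3 - MvPolynomial.C a * MvPolynomial.X 0 :
          MvPolynomial (Fin 4) F)) (fun _ => 1) fun a _ =>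
          (MvPolynomial.isHomogeneous_X F 3).sub (MvPolynomial.isHomogeneous_C_mul_X a 0)
      simpa [hScard] using this
    have hval (o : Option K) : ψ (ev f) o = ∏ a ∈ S, (projY K o ^ (1 + Fintype.card F) -
        algebraMap F K a * projX K o ^ (1 + Fintype.card F)) := by
      change algebraMap F K (MvPolynomial.aeval (e.symm o).1 f) = _
      simp only [f, map_prod, map_sub, map_mul, MvPolynomial.aeval_X, MvPolynomial.aeval_C,
        Algebra.algebraMap_self, RingHom.id_apply, (he o).1, (he o).2.2.2]
    have hnone : ψ (ev f) none = 1 := by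
      rw [hval]
      simp
    have hν (y : K) : algebraMap F K ((e.symm (some y)).1 3) = y ^ (1 + Fintype.card F) :=
      (he (some y)).2.2.2
    refine ⟨ev f, ?_, ?_, ?_⟩
    · rw [hCE]
      exact ⟨f, hf, rfl⟩
    · intro h
      rw [h, map_zero] at hnone
      exact zero_ne_one hnone
    · rw [hwt, card_filter_option, if_neg (by rw [hnone]; exact one_ne_zero), zero_add]
      congr 1
      have hfilter : (Finset.univ.filter fun y => ψ (ev f) (some y) = 0) =
          Finset.univ.filter fun y => (e.symm (some y)).1 3 ∈ S := by
        refine Finset.filter_congr fun y _ => ?_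
        rw [hval, Finset.prod_eq_zero_iff]
        simp_rw [projY_some, projX_some, one_pow, mul_one, ← hν, sub_eq_zero,
          (algebraMap F K).injective.eq_iff, exists_eq_right']
      rw [hfilter, ← Finset.sum_card_fiberwise_eq_card_filter, Finset.sum_congr rfl fun a ha =>
        card_pow_card_add_one_eq hqK hν (Finset.ne_of_mem_erase (hS ha)), Finset.sum_const, hScard,
        smul_eq_mul]
  · intro c hc hc0
    rw [hwt]
    have := card_zeros_le_of_mem_bihomogeneousCode (hmem c hc)
      ((map_ne_zero_iff ψ hψinj).2 hc0)
    omega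
  · have h1 : v ∈ B₀ ↔ v ∈ Submodule.span F (T) := by
      rw [mem_span_iff_of_forall_mem_range hrange, hspan, Submodule.mem_inf]
      refine and_congr Iff.rfl ?_
      simp [Submodule.mem_pi]
    rw [h1, ← hmap]
    constructor
    · rintro ⟨c, hc, rfl⟩
      exact ⟨c, hc, rfl⟩
    · rintro ⟨c, hc, rfl⟩
      exact ⟨c, hc, rfl⟩
end

section
/- For d ≥ 2 and 0 ≤ s < q, the evaluation code C_H(s) on the Segre embedding H ⊂ P^{2^d−1} of d copies of P¹ over F_q has parameters [(q+1)^d, (s+1)^d, (q−s+1)^d], and is the d-fold tensor product of the extended Reed–Solomon code C_{P¹}(s). -/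
open Finset

/-- The normalized homogeneous coordinates of a point of `P¹`, with `none` the point `(0 : 1)`. -/
def projLineCoord {F : Type*} [Field F] (o : Option F) : F × F :=
  o.elim (0, 1) fun x => (1, x)

/-- The evaluation of the `d`-fold tensor product of binary monomials
`u ^ e k * v ^ (s - e k)`. -/
def tensorMonomial {X F : Type*} [Field F] {s d : ℕ} (pt : X → F × F)
    (e : Fin d → Fin (s + 1)) : (Fin d → X) → F :=
  fun P => ∏ k, (pt (P k)).1 ^ (e k : ℕ) * (pt (P k)).2 ^ (s - (e k : ℕ))

/-- The Segre coordinates of a point of a `d`-fold product. -/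
def segreCoord {X F : Type*} [Field F] {d : ℕ} (pt : X → F × F) (P : Fin d → X) :
    (Fin d → Fin 2) → F :=
  fun ε => ∏ k, if ε k = 0 then (pt (P k)).1 else (pt (P k)).2

lemma prod_segreCoord_pow_eq_tensorMonomial {X F : Type*} [Field F] {s d : ℕ} (pt : X → F × F)
    (m : (Fin d → Fin 2) → ℕ) (hm : ∑ ε, m ε = s) :
    ∃ e : Fin d → Fin (s + 1),
      (fun P => ∏ ε, segreCoord pt P ε ^ m ε) = tensorMonomial pt e := by
  have hsplit (k : Fin d) : ∑ ε with ε k = 0, m ε + ∑ ε with ¬ ε k = 0, m ε = s := by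
    rw [sum_filter_add_sum_filter_not, hm]
  refine ⟨fun k => ⟨∑ ε with ε k = 0, m ε, by have := hsplit k; omega⟩, ?_⟩
  funext P
  simp only [segreCoord, tensorMonomial, ← prod_pow]
  rw [prod_comm]
  refine prod_congr rfl fun k _ => ?_
  have hsub : s - ∑ ε with ε k = 0, m ε = ∑ ε with ¬ ε k = 0, m ε := by
    have := hsplit k; omega
  rw [hsub, ← prod_pow_eq_pow_sum, ← prod_pow_eq_pow_sum, prod_filter, prod_filter,
    ← prod_mul_distrib]
  refine prod_congr rfl fun ε _ => ?_
  by_cases h : ε k = 0 <;> simp [h]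

lemma exists_isHomogeneous_eval_segreCoord_eq {X F : Type*} [Field F] {s d : ℕ} (pt : X → F × F)
    (e : Fin d → Fin (s + 1)) :
    ∃ f : MvPolynomial (Fin d → Fin 2) F, f.IsHomogeneous s ∧
      tensorMonomial pt e = fun P => MvPolynomial.eval (segreCoord pt P) f := by
  refine ⟨∏ j ∈ range s, MvPolynomial.X fun k => if j < (e k : ℕ) then 0 else 1, ?_, ?_⟩
  · simpa using MvPolynomial.IsHomogeneous.prod (range s)
      (fun j => (MvPolynomial.X fun k => if j < (e k : ℕ) then 0 else 1 :
        MvPolynomial (Fin d → Fin 2) F)) (fun _ => 1) fun j _ => MvPolynomial.isHomogeneous_X F _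
  · funext P
    simp only [map_prod, MvPolynomial.eval_X, segreCoord, tensorMonomial]
    rw [prod_comm]
    refine prod_congr rfl fun k _ => ?_
    have hk : (e k : ℕ) ≤ s := Nat.lt_succ_iff.mp (e k).2
    have hite (j : ℕ) : (if (if j < (e k : ℕ) then (0 : Fin 2) else 1) = 0
        then (pt (P k)).1 else (pt (P k)).2)
        = if j < (e k : ℕ) then (pt (P k)).1 else (pt (P k)).2 := by
      by_cases h : j < (e k : ℕ) <;> simp [h]
    simp only [hite]
    rw [← prod_range_mul_prod_Ico _ hk]
    congr 1
    · rw [prod_congr rfl fun j hj => if_pos (mem_range.mp hj)]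
      simp
    · rw [prod_congr rfl fun j hj => if_neg (not_lt.mpr (mem_Ico.mp hj).1)]
      simp

lemma span_eval_segreCoord_eq_span_tensorMonomial {X F : Type*} [Field F] (s d : ℕ)
    (pt : X → F × F) :
    Submodule.span F {w | ∃ f : MvPolynomial (Fin d → Fin 2) F, f.IsHomogeneous s ∧
        w = fun P => MvPolynomial.eval (segreCoord pt P) f}
      = Submodule.span F (Set.range (tensorMonomial (s := s) (d := d) pt)) := by
  apply le_antisymm <;> rw [Submodule.span_le]
  · rintro w ⟨f, hf, rfl⟩
    have hw : (fun P => MvPolynomial.eval (segreCoord pt P) f)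
        = ∑ m ∈ f.support, f.coeff m • fun P => ∏ ε, segreCoord pt P ε ^ m ε := by
      funext P
      simp [MvPolynomial.eval_eq']
    rw [hw]
    refine Submodule.sum_mem _ fun m hm => Submodule.smul_mem _ _ ?_
    have hdeg : ∑ ε, m ε = s := by
      rw [← Finsupp.degree_eq_sum, Finsupp.degree_eq_weight_one]
      exact hf (MvPolynomial.mem_support_iff.mp hm)
    obtain ⟨e, he⟩ := prod_segreCoord_pow_eq_tensorMonomial pt m hdeg
    exact Submodule.subset_span ⟨e, he.symm⟩
  · rintro w ⟨e, rfl⟩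
    exact Submodule.subset_span (exists_isHomogeneous_eval_segreCoord_eq pt e)

lemma span_prod_sum_eq_span_tensorMonomial {X F : Type*} [Field F] (s d : ℕ)
    (pt : X → F × F) :
    Submodule.span F {w : (Fin d → X) → F | ∃ g : Fin d → (Fin (s + 1) → F), w = fun P =>
        ∏ k, ∑ i : Fin (s + 1), g k i * (pt (P k)).1 ^ (i : ℕ) * (pt (P k)).2 ^ (s - (i : ℕ))}
      = Submodule.span F (Set.range (tensorMonomial (s := s) (d := d) pt)) := by
  apply le_antisymm <;> rw [Submodule.span_le]
  · rintro w ⟨g, rfl⟩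
    have hw : (fun P : Fin d → X => ∏ k, ∑ i : Fin (s + 1),
          g k i * (pt (P k)).1 ^ (i : ℕ) * (pt (P k)).2 ^ (s - (i : ℕ)))
        = ∑ e : Fin d → Fin (s + 1), (∏ k, g k (e k)) • tensorMonomial pt e := by
      funext P
      rw [prod_univ_sum, Fintype.piFinset_univ]
      simp [tensorMonomial, prod_mul_distrib, mul_assoc]
    rw [hw]
    exact Submodule.sum_mem _ fun e _ => Submodule.smul_mem _ _ (Submodule.subset_span ⟨e, rfl⟩)
  · rintro w ⟨e, rfl⟩
    refine Submodule.subset_span ⟨fun k => Pi.single (e k) 1, ?_⟩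
    funext P
    refine prod_congr rfl fun k _ => ?_
    rw [sum_eq_single (e k)] <;> simp +contextual

lemma pow_le_hammingNorm_sum_smul_prod {X F I : Type*} [Field F] [DecidableEq F] [Fintype X]
    [Fintype I] {δ : ℕ} (b : I → X → F)
    (hb : ∀ a : I → F, a ≠ 0 → δ ≤ hammingNorm fun x => ∑ i, a i * b i x) (d : ℕ)
    (c : (Fin d → I) → F) (hc : c ≠ 0) :
    δ ^ d ≤ hammingNorm fun P : Fin d → X => ∑ e, c e * ∏ k, b (e k) (P k) := by
  induction d with
  | zero =>
    obtain ⟨e, he⟩ := Function.ne_iff.mp hc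
    rw [pow_zero, Nat.one_le_iff_ne_zero, hammingNorm_ne_zero_iff]
    refine Function.ne_iff.mpr ⟨Fin.elim0, ?_⟩
    simpa [Subsingleton.elim default e] using he
  | succ d ih =>
    obtain ⟨e, he⟩ := Function.ne_iff.mp hc
    set u : I → (Fin d → X) → F := fun i P =>
      ∑ t, c (Fin.cons i t) * ∏ k, b (t k) (P k) with hu
    have hcons (x : X) (P : Fin d → X) :
        ∑ e, c e * ∏ k, b (e k) ((Fin.cons x P : Fin (d + 1) → X) k) = ∑ i, u i P * b i x := by
      rw [← (Fin.consEquiv fun _ => I).sum_comp, Fintype.sum_prod_type]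
      refine sum_congr rfl fun i _ => ?_
      rw [hu, sum_mul]
      refine sum_congr rfl fun t _ => ?_
      simp only [Fin.consEquiv, Equiv.coe_fn_mk, Fin.prod_univ_succ, Fin.cons_zero, Fin.cons_succ]
      ring
    have htail : δ ^ d ≤ hammingNorm (u (e 0)) := by
      refine ih (fun t => c (Fin.cons (e 0) t)) (Function.ne_iff.mpr ⟨Fin.tail e, ?_⟩)
      simpa [Fin.cons_self_tail] using he
    have hfiber : ∀ P ∈ ({P | u (e 0) P ≠ 0} : Finset (Fin d → X)),
        δ ≤ #{x | ∑ i, u i P * b i x ≠ 0} := fun P hP =>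
      hb (fun i => u i P) (Function.ne_iff.mpr ⟨e 0, by simpa using hP⟩)
    calc δ ^ (d + 1) = δ ^ d * δ := pow_succ _ _
      _ ≤ hammingNorm (u (e 0)) * δ := Nat.mul_le_mul_right _ htail
      _ ≤ ∑ P with u (e 0) P ≠ 0, #{x | ∑ i, u i P * b i x ≠ 0} := by
        simpa [hammingNorm] using card_nsmul_le_sum _ _ _ hfiber
      _ = #(({P | u (e 0) P ≠ 0} : Finset (Fin d → X)).sigma
            fun P => {x | ∑ i, u i P * b i x ≠ 0}) := (card_sigma _ _).symm
      _ ≤ _ := by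
        refine card_le_card_of_injOn (fun y => (Fin.cons y.2 y.1 : Fin (d + 1) → X)) ?_ ?_
        · intro y hy
          simp only [coe_sigma, Set.mem_sigma_iff, mem_coe, mem_filter, mem_univ, true_and] at hy
          simpa [hcons] using hy.2
        · rintro ⟨P, x⟩ _ ⟨P', x'⟩ _ h
          obtain ⟨rfl, rfl⟩ := Fin.cons_injective2 h
          rfl

/-- Homogenizing a polynomial of degree at most `s` gives a binary form whose value at `(1 : x)`
is `p.eval x` and whose value at `(0 : 1)` is the coefficient of `X ^ s`. -/
lemma hammingNorm_projLine_coeff {F : Type*} [Field F] [Fintype F] [DecidableEq F] {s : ℕ}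
    (p : Polynomial F) (hp : p.natDegree < s + 1) :
    (hammingNorm fun o : Option F => ∑ i : Fin (s + 1), p.coeff (s - (i : ℕ)) *
      ((projLineCoord o).1 ^ (i : ℕ) * (projLineCoord o).2 ^ (s - (i : ℕ))))
      = (if p.coeff s ≠ 0 then 1 else 0) + #{x | p.eval x ≠ 0} := by
  have hnone : ∑ i : Fin (s + 1), p.coeff (s - (i : ℕ)) *
      ((projLineCoord (none : Option F)).1 ^ (i : ℕ) *
        (projLineCoord (none : Option F)).2 ^ (s - (i : ℕ))) = p.coeff s := by
    simp [projLineCoord, Fin.sum_univ_succ]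
  have hsome (x : F) : ∑ i : Fin (s + 1), p.coeff (s - (i : ℕ)) *
      ((projLineCoord (some x)).1 ^ (i : ℕ) *
        (projLineCoord (some x)).2 ^ (s - (i : ℕ))) = p.eval x := by
    rw [Polynomial.eval_eq_sum_range' hp, ← sum_range_reflect, ← Fin.sum_univ_eq_sum_range
      fun i => p.coeff (s + 1 - 1 - i) * x ^ (s + 1 - 1 - i)]
    simp [projLineCoord]
  simp only [hammingNorm, card_filter, Fintype.sum_option, hnone, hsome]

/-- A nonzero binary form of degree `s < q` has at most `s` zeros on the projective line. -/
lemma le_hammingNorm_projLine {F : Type*} [Field F] [Fintype F] [DecidableEq F] {s : ℕ}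
    (hs : s < Fintype.card F) (a : Fin (s + 1) → F) (ha : a ≠ 0) :
    Fintype.card F - s + 1 ≤ hammingNorm fun o : Option F => ∑ i : Fin (s + 1), a i *
      ((projLineCoord o).1 ^ (i : ℕ) * (projLineCoord o).2 ^ (s - (i : ℕ))) := by
  set p : Polynomial F := Polynomial.ofFn (s + 1) (a ∘ Fin.rev) with hp
  have hdeg : p.natDegree < s + 1 := Polynomial.ofFn_natDegree_lt (by omega) _
  have hcoeff (i : Fin (s + 1)) : a i = p.coeff (s - (i : ℕ)) := by
    rw [hp, Polynomial.ofFn_coeff_eq_val_of_lt _ (by omega), Function.comp_apply]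
    congr 1
    ext
    simp only [Fin.val_rev]
    omega
  have hp0 : p ≠ 0 := by
    intro h
    exact ha (funext fun i => by simp [hcoeff i, h])
  have hroots : #{x | p.eval x = 0} ≤ p.natDegree := by
    refine Polynomial.card_le_degree_of_subset_roots fun x hx => ?_
    simpa [hp0] using hx
  have hsplit := card_filter_add_card_filter_not (s := (univ : Finset F)) fun x => p.eval x = 0
  rw [card_univ] at hsplit
  simp only [hcoeff]
  rw [hammingNorm_projLine_coeff p hdeg]
  split_ifs with htop
  · simp only [ne_eq]
    omega
  · have hne : p.natDegree ≠ s := by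
      rintro h
      rw [← h, Polynomial.coeff_natDegree, Polynomial.leadingCoeff_ne_zero] at htop
      exact htop hp0
    simp only [ne_eq]
    omega

lemma exists_hammingNorm_projLine_eq {F : Type*} [Field F] [Fintype F] [DecidableEq F] {s : ℕ}
    (hs : s ≤ Fintype.card F) : ∃ a : Fin (s + 1) → F,
    (hammingNorm fun o : Option F => ∑ i : Fin (s + 1), a i *
      (projLineCoord o).1 ^ (i : ℕ) * (projLineCoord o).2 ^ (s - (i : ℕ)))
      = Fintype.card F - s + 1 := by
  obtain ⟨S, -, hS⟩ := exists_subset_card_eq (s := (univ : Finset F)) hs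
  set p : Polynomial F := ∏ x ∈ S, (Polynomial.X - Polynomial.C x) with hp
  have hmonic : p.Monic := Polynomial.monic_prod_X_sub_C _ _
  have hdeg : p.natDegree = s := by
    rw [hp, Polynomial.natDegree_finsetProd_X_sub_C_eq_card, hS]
  have htop : p.coeff s = 1 := by
    rw [← hdeg]
    exact hmonic
  have hzeros : ({x | p.eval x ≠ 0} : Finset F) = Sᶜ := by
    ext x
    simp [hp, Polynomial.eval_prod, prod_ne_zero_iff, sub_eq_zero]
  refine ⟨fun i => p.coeff (s - (i : ℕ)), ?_⟩
  simp only [mul_assoc]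
  rw [hammingNorm_projLine_coeff p (by omega), hzeros, card_compl, hS]
  simp [htop, add_comm]

lemma hammingNorm_prod {X F : Type*} [Field F] [DecidableEq F] [Fintype X] (d : ℕ) (w : X → F) :
    hammingNorm (fun P : Fin d → X => ∏ k, w (P k)) = hammingNorm w ^ d := by
  classical
  have h : ({P | ∏ k, w (P k) ≠ 0} : Finset (Fin d → X))
      = Fintype.piFinset fun _ => {x | w x ≠ 0} := by
    ext P
    simp [prod_ne_zero_iff]
  simp only [hammingNorm]
  rw [h, Fintype.card_piFinset]
  simp


/-- For `d ≥ 2` and `0 ≤ s < q`, the evaluation code `C_H(s)` on the Segre embedding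
`H ⊂ P^{2^d-1}` of `d` copies of `P¹` over `F_q` has parameters
`[(q+1)^d, (s+1)^d, (q-s+1)^d]`, and equals the `d`-fold tensor product of the
extended Reed–Solomon code `C_{P¹}(s)`. -/
theorem stmt_17 (F : Type) [Field F] [Fintype F] [DecidableEq F] (q s d : ℕ)
    (hqF : Fintype.card F = q) (hs : s < q) (hd : 2 ≤ d) :
    -- normalized coordinates on each P¹ factor
    let pt : Option F → F × F := fun o => o.elim (0, 1) fun x => (1, x)
    -- the Segre coordinates of a point of (P¹)^d, indexed by Fin d → Fin 2
    let seg : (Fin d → Option F) → ((Fin d → Fin 2) → F) :=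
      fun P ε => ∏ k, if ε k = 0 then (pt (P k)).1 else (pt (P k)).2
    -- the evaluation code C_H(s)
    let CH : Submodule F ((Fin d → Option F) → F) := Submodule.span F
      {w | ∃ f : MvPolynomial (Fin d → Fin 2) F, f.IsHomogeneous s ∧
        w = fun P => MvPolynomial.eval (seg P) f}
    -- the d-fold tensor product of the extended Reed–Solomon code C_{P¹}(s)
    let T : Submodule F ((Fin d → Option F) → F) := Submodule.span F
      {w | ∃ g : Fin d → (Fin (s + 1) → F), w = fun P =>
        ∏ k, ∑ i : Fin (s + 1), g k i * (pt (P k)).1 ^ (i : ℕ) * (pt (P k)).2 ^ (s - (i : ℕ))}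
    Fintype.card (Fin d → Option F) = (q + 1) ^ d ∧
    Module.finrank F CH = (s + 1) ^ d ∧
    (∃ c ∈ CH, c ≠ 0 ∧ hammingNorm c = (q - s + 1) ^ d) ∧
    (∀ c ∈ CH, c ≠ 0 → (q - s + 1) ^ d ≤ hammingNorm c) ∧
    CH = T := by
  intro pt seg CH T
  subst hqF
  have hCH : CH = Submodule.span F (Set.range (tensorMonomial (s := s) (d := d) pt)) :=
    span_eval_segreCoord_eq_span_tensorMonomial s d pt
  have hT : T = Submodule.span F (Set.range (tensorMonomial (s := s) (d := d) pt)) :=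
    span_prod_sum_eq_span_tensorMonomial s d pt
  have hdist (c : (Fin d → Fin (s + 1)) → F) (hc : c ≠ 0) :
      (Fintype.card F - s + 1) ^ d ≤ hammingNorm (∑ e, c e • tensorMonomial pt e) := by
    convert pow_le_hammingNorm_sum_smul_prod _ (le_hammingNorm_projLine hs) d c hc using 2
    funext P
    simp only [Finset.sum_apply, Pi.smul_apply, smul_eq_mul]
    rfl
  have hpos : 0 < (Fintype.card F - s + 1) ^ d := by positivity
  have hli : LinearIndependent F (tensorMonomial (s := s) (d := d) pt) := by
    rw [Fintype.linearIndependent_iff]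
    intro c hsum
    by_contra! hne
    have hle := hdist c (Function.ne_iff.mpr hne)
    rw [hsum, hammingNorm_zero] at hle
    omega
  refine ⟨by simp, ?_, ?_, ?_, hCH.trans hT.symm⟩
  · rw [hCH, finrank_span_eq_card hli]
    simp
  · obtain ⟨a, ha⟩ := exists_hammingNorm_projLine_eq hs.le
    have hnorm := (hammingNorm_prod d _).trans (congrArg (· ^ d) ha)
    refine ⟨_, ?_, ?_, hnorm⟩
    · rw [hCH, ← hT]
      exact Submodule.subset_span ⟨fun _ => a, rfl⟩
    · rw [← hammingNorm_ne_zero_iff, hnorm]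
      exact hpos.ne'
  · intro c hc hne
    rw [hCH, Submodule.mem_span_range_iff_exists_fun] at hc
    obtain ⟨a, rfl⟩ := hc
    refine hdist a ?_
    rintro rfl
    simp at hne
end
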